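/- arXiv:2208.10622 — 5 statements merged into one kernel-verified Lean document; each statement's English description precedes it below -/
import Mathlib

section
/- Let P ⊆ ℝ⁷ be an associative 3-plane. Then there exist g ∈ G and real numbers s, r with s ≥ 0, 3s ≤ r, and r ≤ π/2 such that g(P) = P_{s,r}. Moreover the pair (s,r) is unique subject to these constraints: if g(P) = P_{s,r} and g′(P) = P_{s′,r′} with g, g′ ∈ G and both (s,r) and (s′,r′) satisfy s ≥ 0, 3s ≤ r, r ≤ π/2, then s = s′ and r = r′. -/
open Real

noncomputable section

/-- ℝ⁷ with its Euclidean structure. -/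
abbrev E7 := EuclideanSpace ℝ (Fin 7)

/-- The standard orthonormal basis vectors of ℝ⁷ (0-indexed: `e 0` is e₁, ..., `e 6` is e₇). -/
def e (i : Fin 7) : E7 := EuclideanSpace.single i (1 : ℝ)

/-- `trip i j k u v w` is `e^{i+1,j+1,k+1}(u,v,w)`: the determinant of the 3×3 matrix whose
columns are the (i,j,k)-coordinates of u, v, w. -/
def trip (i j k : Fin 7) (u v w : E7) : ℝ :=
  Matrix.det !![u i, v i, w i; u j, v j, w j; u k, v k, w k]

/-- The standard G₂ 3-form φ₀ = e^{123} + e^{145} + e^{167} + e^{246} − e^{257} − e^{347} − e^{356}. -/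
def phi0 (u v w : E7) : ℝ :=
  trip 0 1 2 u v w + trip 0 3 4 u v w + trip 0 5 6 u v w + trip 1 3 5 u v w
    - trip 1 4 6 u v w - trip 2 3 6 u v w - trip 2 4 5 u v w

/-- A 3-plane is associative if it is the span of an orthonormal triple (u₁,u₂,u₃) with
φ₀(u₁,u₂,u₃) = 1. -/
def IsAssociative (P : Submodule ℝ E7) : Prop :=
  ∃ u₁ u₂ u₃ : E7, Orthonormal ℝ ![u₁, u₂, u₃] ∧ phi0 u₁ u₂ u₃ = 1 ∧
    P = Submodule.span ℝ {u₁, u₂, u₃}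

/-- The associative 3-plane A = span(e₁, e₂, e₃). -/
def A : Submodule ℝ E7 := Submodule.span ℝ {e 0, e 1, e 2}

/-- First spanning vector of P_{s,r}: cos(2s)e₁ + sin(2s)e₆. -/
def w1 (s r : ℝ) : E7 := Real.cos (2 * s) • e 0 + Real.sin (2 * s) • e 5

/-- Second spanning vector of P_{s,r}: cos(s−r)e₂ + sin(s−r)e₅. -/
def w2 (s r : ℝ) : E7 := Real.cos (s - r) • e 1 + Real.sin (s - r) • e 4

/-- Third spanning vector of P_{s,r}: cos(s+r)e₃ + sin(s+r)e₄. -/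
def w3 (s r : ℝ) : E7 := Real.cos (s + r) • e 2 + Real.sin (s + r) • e 3

/-- The normal-form associative 3-plane P_{s,r}. -/
def Psr (s r : ℝ) : Submodule ℝ E7 := Submodule.span ℝ {w1 s r, w2 s r, w3 s r}


lemma inner7 (u v : E7) : inner ℝ u v = u 0 * v 0 + u 1 * v 1 + u 2 * v 2 + u 3 * v 3
    + u 4 * v 4 + u 5 * v 5 + u 6 * v 6 := by
  rw [PiLp.inner_apply]
  simp [Fin.sum_univ_succ]
  ring

/-- cross product -/
def cr (u v : E7) : E7 := !₂[
  (u 1 * v 2 - u 2 * v 1) + (u 3 * v 4 - u 4 * v 3) + (u 5 * v 6 - u 6 * v 5),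
  (u 2 * v 0 - u 0 * v 2) + (u 3 * v 5 - u 5 * v 3) - (u 4 * v 6 - u 6 * v 4),
  (u 0 * v 1 - u 1 * v 0) - (u 3 * v 6 - u 6 * v 3) - (u 4 * v 5 - u 5 * v 4),
  (u 4 * v 0 - u 0 * v 4) + (u 5 * v 1 - u 1 * v 5) - (u 6 * v 2 - u 2 * v 6),
  (u 0 * v 3 - u 3 * v 0) - (u 6 * v 1 - u 1 * v 6) - (u 5 * v 2 - u 2 * v 5),
  (u 6 * v 0 - u 0 * v 6) + (u 1 * v 3 - u 3 * v 1) - (u 2 * v 4 - u 4 * v 2),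
  (u 0 * v 5 - u 5 * v 0) - (u 1 * v 4 - u 4 * v 1) - (u 2 * v 3 - u 3 * v 2)]

lemma cr0 (u v : E7) : cr u v 0 = (u 1 * v 2 - u 2 * v 1) + (u 3 * v 4 - u 4 * v 3) + (u 5 * v 6 - u 6 * v 5) := rfl
lemma cr1 (u v : E7) : cr u v 1 = (u 2 * v 0 - u 0 * v 2) + (u 3 * v 5 - u 5 * v 3) - (u 4 * v 6 - u 6 * v 4) := rfl
lemma cr2 (u v : E7) : cr u v 2 = (u 0 * v 1 - u 1 * v 0) - (u 3 * v 6 - u 6 * v 3) - (u 4 * v 5 - u 5 * v 4) := rfl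
lemma cr3 (u v : E7) : cr u v 3 = (u 4 * v 0 - u 0 * v 4) + (u 5 * v 1 - u 1 * v 5) - (u 6 * v 2 - u 2 * v 6) := rfl
lemma cr4 (u v : E7) : cr u v 4 = (u 0 * v 3 - u 3 * v 0) - (u 6 * v 1 - u 1 * v 6) - (u 5 * v 2 - u 2 * v 5) := rfl
lemma cr5 (u v : E7) : cr u v 5 = (u 6 * v 0 - u 0 * v 6) + (u 1 * v 3 - u 3 * v 1) - (u 2 * v 4 - u 4 * v 2) := rfl
lemma cr6 (u v : E7) : cr u v 6 = (u 0 * v 5 - u 5 * v 0) - (u 1 * v 4 - u 4 * v 1) - (u 2 * v 3 - u 3 * v 2) := rfl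

lemma ext7 {u v : E7} (h0 : u 0 = v 0) (h1 : u 1 = v 1) (h2 : u 2 = v 2) (h3 : u 3 = v 3)
    (h4 : u 4 = v 4) (h5 : u 5 = v 5) (h6 : u 6 = v 6) : u = v := by
  ext i; fin_cases i <;> assumption

lemma phi_cr (u v w : E7) : phi0 u v w = inner ℝ (cr u v) w := by
  rw [inner7, cr0, cr1, cr2, cr3, cr4, cr5, cr6]
  simp only [phi0, trip, Matrix.det_fin_three, Matrix.of_apply, Matrix.cons_val', Matrix.cons_val_zero,
    Matrix.cons_val_one, Matrix.cons_val, Matrix.cons_val_fin_one]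
  ring

lemma cr_inner (u v : E7) : inner ℝ (cr u v) (cr u v) =
    inner ℝ u u * inner ℝ v v - inner ℝ u v * inner ℝ u v := by
  simp only [inner7, cr0, cr1, cr2, cr3, cr4, cr5, cr6]
  ring

lemma cr_inner_left (u v : E7) : inner ℝ u (cr u v) = 0 := by
  simp only [inner7, cr0, cr1, cr2, cr3, cr4, cr5, cr6]
  ring

lemma cr_inner_right (u v : E7) : inner ℝ v (cr u v) = 0 := by
  simp only [inner7, cr0, cr1, cr2, cr3, cr4, cr5, cr6]
  ring

/-- projection to A -/
def q (u v : E7) : ℝ := u 0 * v 0 + u 1 * v 1 + u 2 * v 2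

lemma e_apply (i j : Fin 7) : e i j = if j = i then 1 else 0 := by
  simp [e]

lemma mem_A (x : E7) : x ∈ A ↔ x 3 = 0 ∧ x 4 = 0 ∧ x 5 = 0 ∧ x 6 = 0 := by
  unfold A
  rw [Submodule.mem_span_triple]
  constructor
  · rintro ⟨a, b, c, rfl⟩
    simp [e_apply]
  · rintro ⟨h3, h4, h5, h6⟩
    refine ⟨x 0, x 1, x 2, ?_⟩
    apply ext7 <;> simp [e_apply, *]

/-- the group G -/
def InG (g : E7 ≃ₗᵢ[ℝ] E7) : Prop :=
  (∀ u v w : E7, phi0 (g u) (g v) (g w) = phi0 u v w) ∧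
      Submodule.map (g.toLinearEquiv : E7 →ₗ[ℝ] E7) A = A

lemma InG.trans {g h : E7 ≃ₗᵢ[ℝ] E7} (hg : InG g) (hh : InG h) : InG (g.trans h) := by
  refine ⟨fun u v w => ?_, ?_⟩
  · simp [hh.1, hg.1]
  · conv_rhs => rw [← hh.2, ← hg.2, ← Submodule.map_comp]
    rfl

lemma map_symm_of {g : E7 ≃ₗᵢ[ℝ] E7} {P Q : Submodule ℝ E7}
    (h : Submodule.map (g.toLinearEquiv : E7 →ₗ[ℝ] E7) P = Q) :
    Submodule.map (g.symm.toLinearEquiv : E7 →ₗ[ℝ] E7) Q = P := by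
  subst h
  ext x
  simp

lemma InG.symm {g : E7 ≃ₗᵢ[ℝ] E7} (hg : InG g) : InG g.symm := by
  refine ⟨fun u v w => ?_, map_symm_of hg.2⟩
  rw [← hg.1]; simp

lemma InG.mem {g : E7 ≃ₗᵢ[ℝ] E7} (hg : InG g) {x : E7} (hx : x ∈ A) : g x ∈ A := by
  have : g x ∈ Submodule.map (g.toLinearEquiv : E7 →ₗ[ℝ] E7) A := ⟨x, hx, rfl⟩
  rwa [hg.2] at this

lemma InG.cr {g : E7 ≃ₗᵢ[ℝ] E7} (hg : InG g) (u v : E7) : cr (g u) (g v) = g (cr u v) := by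
  refine ext_inner_right ℝ fun w => ?_
  obtain ⟨w, rfl⟩ := g.surjective w
  rw [← phi_cr, hg.1, phi_cr, g.inner_map_map]

/-- projection -/
def D (x : E7) : E7 := !₂[x 0, x 1, x 2, 0, 0, 0, 0]

lemma D_mem (x : E7) : D x ∈ A := by
  rw [mem_A]; simp [D]

lemma q_eq (u v : E7) : q u v = inner ℝ (D u) v := by
  rw [inner7]; simp [D, q]

lemma inner_D (a x : E7) (ha : a ∈ A) : inner ℝ a (D x) = inner ℝ a x := by
  rw [mem_A] at ha
  rw [inner7, inner7]; simp [D, ha]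

lemma D_char (x y : E7) (hy : y ∈ A) (h : ∀ a ∈ A, inner ℝ a y = inner ℝ a x) : D x = y := by
  have h0 : inner ℝ (D x - y) (D x - y) = 0 := by
    have hm : D x - y ∈ A := sub_mem (D_mem x) hy
    rw [inner_sub_right, inner_D _ _ hm, h _ hm]; simp
  exact sub_eq_zero.1 (inner_self_eq_zero.1 h0)

lemma InG.D {g : E7 ≃ₗᵢ[ℝ] E7} (hg : InG g) (x : E7) : D (g x) = g (D x) := by
  apply D_char _ _ (hg.mem (D_mem x))
  intro a ha
  have h1 := hg.symm.mem ha
  have : a = g (g.symm a) := by simp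
  rw [this, g.inner_map_map, g.inner_map_map, inner_D _ _ h1]

lemma InG.q {g : E7 ≃ₗᵢ[ℝ] E7} (hg : InG g) (u v : E7) : q (g u) (g v) = q u v := by
  rw [q_eq, q_eq, hg.D, g.inner_map_map]

/-- building elements of G -/
lemma mkG (f : E7 →ₗ[ℝ] E7) (hn : ∀ x, inner ℝ (f x) (f x) = inner ℝ x x)
    (hphi : ∀ u v w : E7, phi0 (f u) (f v) (f w) = phi0 u v w)
    (hA : ∀ x ∈ A, f x ∈ A) : ∃ g, InG g ∧ ∀ x, g x = f x := by
  have hf : ∀ x, ‖f x‖ = ‖x‖ := by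
    intro x
    rw [norm_eq_sqrt_real_inner, norm_eq_sqrt_real_inner, hn]
  let li : E7 →ₗᵢ[ℝ] E7 := ⟨f, hf⟩
  let g := li.toLinearIsometryEquiv rfl
  refine ⟨g, ⟨hphi, ?_⟩, fun x => rfl⟩
  apply Submodule.eq_of_le_of_finrank_eq
  · rintro _ ⟨x, hx, rfl⟩
    exact hA x hx
  · exact LinearEquiv.finrank_map_eq g.toLinearEquiv A

lemma exists_M (b m : Fin 4 → ℝ) (hb : b 0 ^ 2 + b 1 ^ 2 + b 2 ^ 2 + b 3 ^ 2
    = m 0 ^ 2 + m 1 ^ 2 + m 2 ^ 2 + m 3 ^ 2) : ∃ g, InG g ∧ 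
    (∀ x : E7, g x 0 = x 0 ∧ g x 1 = x 1 ∧ g x 2 = x 2) ∧
    ∀ x : E7, x 3 = b 0 → x 4 = b 1 → x 5 = b 2 → x 6 = b 3 → 
      g x 3 = m 0 ∧ g x 4 = m 1 ∧ g x 5 = m 2 ∧ g x 6 = m 3 := by
  have key : ∃ p q r t : ℝ, p ^ 2 + q ^ 2 + r ^ 2 + t ^ 2 = 1 ∧
      b 0 * p - b 1 * q - b 2 * r - b 3 * t = m 0 ∧
      b 0 * q + b 1 * p + b 2 * t - b 3 * r = m 1 ∧
      b 0 * r - b 1 * t + b 2 * p + b 3 * q = m 2 ∧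
      b 0 * t + b 1 * r - b 2 * q + b 3 * p = m 3 := by
    by_cases h0 : b 0 ^ 2 + b 1 ^ 2 + b 2 ^ 2 + b 3 ^ 2 = 0
    · have hm := hb.symm.trans h0
      have z0 : b 0 = 0 := by nlinarith [sq_nonneg (b 0), sq_nonneg (b 1), sq_nonneg (b 2), sq_nonneg (b 3)]
      have z1 : b 1 = 0 := by nlinarith [sq_nonneg (b 0), sq_nonneg (b 1), sq_nonneg (b 2), sq_nonneg (b 3)]
      have z2 : b 2 = 0 := by nlinarith [sq_nonneg (b 0), sq_nonneg (b 1), sq_nonneg (b 2), sq_nonneg (b 3)]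
      have z3 : b 3 = 0 := by nlinarith [sq_nonneg (b 0), sq_nonneg (b 1), sq_nonneg (b 2), sq_nonneg (b 3)]
      have y0 : m 0 = 0 := by nlinarith [sq_nonneg (m 0), sq_nonneg (m 1), sq_nonneg (m 2), sq_nonneg (m 3)]
      have y1 : m 1 = 0 := by nlinarith [sq_nonneg (m 0), sq_nonneg (m 1), sq_nonneg (m 2), sq_nonneg (m 3)]
      have y2 : m 2 = 0 := by nlinarith [sq_nonneg (m 0), sq_nonneg (m 1), sq_nonneg (m 2), sq_nonneg (m 3)]
      have y3 : m 3 = 0 := by nlinarith [sq_nonneg (m 0), sq_nonneg (m 1), sq_nonneg (m 2), sq_nonneg (m 3)]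
      exact ⟨1, 0, 0, 0, by norm_num, by simp [*], by simp [*], by simp [*], by simp [*]⟩
    · set n := b 0 ^ 2 + b 1 ^ 2 + b 2 ^ 2 + b 3 ^ 2 with hn
      refine ⟨(b 0 * m 0 + b 1 * m 1 + b 2 * m 2 + b 3 * m 3) / n,
        (-b 1 * m 0 + b 0 * m 1 + b 3 * m 2 - b 2 * m 3) / n,
        (-b 2 * m 0 - b 3 * m 1 + b 0 * m 2 + b 1 * m 3) / n,
        (-b 3 * m 0 + b 2 * m 1 - b 1 * m 2 + b 0 * m 3) / n, ?_, ?_, ?_, ?_, ?_⟩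
      · field_simp
        have : n ^ 2 = n * (m 0 ^ 2 + m 1 ^ 2 + m 2 ^ 2 + m 3 ^ 2) := by rw [← hb]; ring
        rw [this, hn]; ring
      all_goals field_simp; rw [hn]; ring
  obtain ⟨p, q, r, t, h1, k0, k1, k2, k3⟩ := key
  let f : E7 →ₗ[ℝ] E7 :=
    { toFun := fun y => !₂[y 0, y 1, y 2, y 3 * p - y 4 * q - y 5 * r - y 6 * t,
        y 3 * q + y 4 * p + y 5 * t - y 6 * r, y 3 * r - y 4 * t + y 5 * p + y 6 * q,
        y 3 * t + y 4 * r - y 5 * q + y 6 * p]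
      map_add' := by intro x y; apply ext7 <;> simp <;> ring
      map_smul' := by intro x y; apply ext7 <;> simp <;> ring }
  have f0 : ∀ y, f y 0 = y 0 := fun y => rfl
  have f1 : ∀ y, f y 1 = y 1 := fun y => rfl
  have f2 : ∀ y, f y 2 = y 2 := fun y => rfl
  have f3 : ∀ y, f y 3 = y 3 * p - y 4 * q - y 5 * r - y 6 * t := fun y => rfl
  have f4 : ∀ y, f y 4 = y 3 * q + y 4 * p + y 5 * t - y 6 * r := fun y => rfl
  have f5 : ∀ y, f y 5 = y 3 * r - y 4 * t + y 5 * p + y 6 * q := fun y => rfl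
  have f6 : ∀ y, f y 6 = y 3 * t + y 4 * r - y 5 * q + y 6 * p := fun y => rfl
  obtain ⟨g, hg, hgf⟩ := mkG f (by
      intro x
      rw [inner7, inner7, f0, f1, f2, f3, f4, f5, f6]
      linear_combination (x 3 ^ 2 + x 4 ^ 2 + x 5 ^ 2 + x 6 ^ 2) * h1)
    (by
      intro u v w
      have e1 : phi0 (f u) (f v) (f w) = (p ^ 2 + q ^ 2 + r ^ 2 + t ^ 2) * (phi0 u v w - 
        trip 0 1 2 u v w) + trip 0 1 2 u v w := by
        simp only [phi0, trip, Matrix.det_fin_three, Matrix.of_apply, Matrix.cons_val',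
          Matrix.cons_val_zero, Matrix.cons_val_one, Matrix.cons_val, Matrix.cons_val_fin_one,
          f0, f1, f2, f3, f4, f5, f6]
        ring
      rw [e1, h1]; ring)
    (by
      intro x hx
      rw [mem_A] at hx ⊢
      simp [f3, f4, f5, f6, hx])
  refine ⟨g, hg, fun x => ⟨by rw [hgf, f0], by rw [hgf, f1], by rw [hgf, f2]⟩, ?_⟩
  intro x x3 x4 x5 x6
  rw [hgf, f3, f4, f5, f6, x3, x4, x5, x6]
  exact ⟨k0, k1, k2, k3⟩

def d3 (x y z x' y' z' : ℝ) : ℝ := x * x' + y * y' + z * z'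
def t3 (x y z x' y' z' x'' y'' z'' : ℝ) : ℝ :=
  x * (y' * z'' - z' * y'') + y * (z' * x'' - x' * z'') + z * (x' * y'' - y' * x'')

lemma phi_dt (u v w : E7) : phi0 u v w =
   t3 (u 0) (u 1) (u 2) (v 0) (v 1) (v 2) (w 0) (w 1) (w 2)
   - t3 (u 0) (u 1) (u 2) (v 4) (v 5) (-v 6) (w 4) (w 5) (-w 6)
   - t3 (v 0) (v 1) (v 2) (w 4) (w 5) (-w 6) (u 4) (u 5) (-u 6)
   - t3 (w 0) (w 1) (w 2) (u 4) (u 5) (-u 6) (v 4) (v 5) (-v 6)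
   + v 3 * d3 (u 0) (u 1) (u 2) (w 4) (w 5) (-w 6)
   - w 3 * d3 (u 0) (u 1) (u 2) (v 4) (v 5) (-v 6)
   + w 3 * d3 (v 0) (v 1) (v 2) (u 4) (u 5) (-u 6)
   - u 3 * d3 (v 0) (v 1) (v 2) (w 4) (w 5) (-w 6)
   + u 3 * d3 (w 0) (w 1) (w 2) (v 4) (v 5) (-v 6)
   - v 3 * d3 (w 0) (w 1) (w 2) (u 4) (u 5) (-u 6) := by
  simp only [phi0, trip, Matrix.det_fin_three, Matrix.of_apply, Matrix.cons_val',
          Matrix.cons_val_zero, Matrix.cons_val_one, Matrix.cons_val, Matrix.cons_val_fin_one, d3, t3]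
  ring

lemma exists_R (a b c x y z : ℝ) (h1 : a ^ 2 + b ^ 2 + c ^ 2 = 1) (h2 : x ^ 2 + y ^ 2 + z ^ 2 = 1)
    (h3 : a * x + b * y + c * z = 0) : ∃ g, InG g ∧ ∀ u : E7,
    g u 0 = a * u 0 + b * u 1 + c * u 2 ∧ g u 1 = x * u 0 + y * u 1 + z * u 2 ∧ 
    g u 2 = (b * z - c * y) * u 0 + (c * x - a * z) * u 1 + (a * y - b * x) * u 2 := by
  obtain ⟨k, hk⟩ : ∃ k, k = b * z - c * y := ⟨_, rfl⟩
  obtain ⟨l, hl⟩ : ∃ l, l = c * x - a * z := ⟨_, rfl⟩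
  obtain ⟨m, hm⟩ : ∃ m, m = a * y - b * x := ⟨_, rfl⟩
  rw [← hk, ← hl, ← hm]
  have n1 : k ^ 2 + l ^ 2 + m ^ 2 = 1 := by
    rw [hk, hl, hm]
    linear_combination (x ^ 2 + y ^ 2 + z ^ 2) * h1 + h2 - (a * x + b * y + c * z) * h3
  have n2 : a * k + b * l + c * m = 0 := by rw [hk, hl, hm]; ring
  have n3 : x * k + y * l + z * m = 0 := by rw [hk, hl, hm]; ring
  have hM : !![a, b, c; x, y, z; k, l, m] * (!![a, b, c; x, y, z; k, l, m]).transpose = 1 := by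
    ext i j
    fin_cases i <;> fin_cases j <;> simp [Matrix.mul_apply, Fin.sum_univ_three] <;> linarith
  have hM2 := mul_eq_one_comm.1 hM
  have M00 := congrFun (congrFun hM2 0) 0
  have M01 := congrFun (congrFun hM2 0) 1
  have M02 := congrFun (congrFun hM2 0) 2
  have M11 := congrFun (congrFun hM2 1) 1
  have M12 := congrFun (congrFun hM2 1) 2
  have M22 := congrFun (congrFun hM2 2) 2
  simp [Matrix.mul_apply, Fin.sum_univ_three] at M00 M01 M02 M11 M12 M22
  have hdet : t3 a b c x y z k l m = 1 := by
    unfold t3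
    rw [hk, hl, hm] at n1 ⊢
    linear_combination n1
  have hd : ∀ p q r p' q' r' : ℝ, d3 (a * p + b * q + c * r) (x * p + y * q + z * r)
      (k * p + l * q + m * r) (a * p' + b * q' + c * r') (x * p' + y * q' + z * r')
      (k * p' + l * q' + m * r') = d3 p q r p' q' r' := by
    intro p q r p' q' r'
    unfold d3
    linear_combination p * p' * M00 + q * q' * M11 + r * r' * M22 + (p * q' + q * p') * M01
      + (p * r' + r * p') * M02 + (q * r' + r * q') * M12
  have ht : ∀ p q r p' q' r' p'' q'' r'' : ℝ, t3 (a * p + b * q + c * r) (x * p + y * q + z * r)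
      (k * p + l * q + m * r) (a * p' + b * q' + c * r') (x * p' + y * q' + z * r')
      (k * p' + l * q' + m * r') (a * p'' + b * q'' + c * r'') (x * p'' + y * q'' + z * r'')
      (k * p'' + l * q'' + m * r'') = t3 p q r p' q' r' p'' q'' r'' := by
    intro p q r p' q' r' p'' q'' r''
    rw [← one_mul (t3 p q r p' q' r' p'' q'' r''), ← hdet]
    unfold t3
    ring
  let f : E7 →ₗ[ℝ] E7 :=
    { toFun := fun u => !₂[a * u 0 + b * u 1 + c * u 2, x * u 0 + y * u 1 + z * u 2,
        k * u 0 + l * u 1 + m * u 2, u 3, a * u 4 + b * u 5 + c * (- u 6),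
        x * u 4 + y * u 5 + z * (- u 6), - (k * u 4 + l * u 5 + m * (- u 6))]
      map_add' := by intro x y; apply ext7 <;> simp <;> ring
      map_smul' := by intro x y; apply ext7 <;> simp <;> ring }
  have f0 : ∀ u, f u 0 = a * u 0 + b * u 1 + c * u 2 := fun y => rfl
  have f1 : ∀ u, f u 1 = x * u 0 + y * u 1 + z * u 2 := fun y => rfl
  have f2 : ∀ u, f u 2 = k * u 0 + l * u 1 + m * u 2 := fun y => rfl
  have f3 : ∀ y, f y 3 = y 3 := fun y => rfl
  have f4 : ∀ u, f u 4 = a * u 4 + b * u 5 + c * (- u 6) := fun y => rfl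
  have f5 : ∀ u, f u 5 = x * u 4 + y * u 5 + z * (- u 6) := fun y => rfl
  have f6 : ∀ u, f u 6 = -(k * u 4 + l * u 5 + m * (- u 6)) := fun y => rfl
  obtain ⟨g, hg, hgf⟩ := mkG f (by
      intro u
      have i1 := hd (u 0) (u 1) (u 2) (u 0) (u 1) (u 2)
      have i2 := hd (u 4) (u 5) (-u 6) (u 4) (u 5) (-u 6)
      rw [inner7, inner7, f0, f1, f2, f3, f4, f5, f6]
      unfold d3 at i1 i2
      linear_combination i1 + i2)
    (by
      intro u v w
      rw [phi_dt, phi_dt]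
      simp only [f0, f1, f2, f3, f4, f5, f6, neg_neg, hd, ht])
    (by
      intro x hx
      rw [mem_A] at hx ⊢
      simp [f3, f4, f5, f6, hx])
  exact ⟨g, hg, fun u => ⟨by rw [hgf, f0], by rw [hgf, f1], by rw [hgf, f2]⟩⟩

lemma cr_eq_of {u v w : E7} (hu : inner ℝ u u = 1) (hv : inner ℝ v v = 1) (hw : inner ℝ w w = 1)
    (huv : inner ℝ u v = 0) (h : phi0 u v w = 1) : cr u v = w := by
  rw [phi_cr] at h
  have h0 : inner ℝ (cr u v - w) (cr u v - w) = 0 := by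
    rw [inner_sub_left, inner_sub_right, inner_sub_right, real_inner_comm (cr u v) w, h, cr_inner,
      hu, hv, hw, huv]; norm_num
  exact sub_eq_zero.1 (inner_self_eq_zero.1 h0)

lemma phi_cyc (u v w : E7) : phi0 v w u = phi0 u v w := by
  simp only [phi_cr, inner7, cr0, cr1, cr2, cr3, cr4, cr5, cr6]
  ring

lemma cr_comb (a b c x y z : ℝ) (u v w : E7) : cr (a • u + b • v + c • w) (x • u + y • v + z • w) =
    (a * y - b * x) • cr u v + (b * z - c * y) • cr v w + (c * x - a * z) • cr w u := by
  apply ext7 <;> simp only [PiLp.add_apply, PiLp.smul_apply, smul_eq_mul, cr0, cr1, cr2, cr3, cr4, cr5, cr6] <;> ring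

/-- adapted pair -/
structure Nice (v1 v2 : E7) : Prop where
  h11 : inner ℝ v1 v1 = 1
  h22 : inner ℝ v2 v2 = 1
  h12 : inner ℝ v1 v2 = 0
  q12 : q v1 v2 = 0
  q13 : q v1 (cr v1 v2) = 0
  q23 : q v2 (cr v1 v2) = 0
  l12 : q v2 v2 ≤ q v1 v1
  l23 : q (cr v1 v2) (cr v1 v2) ≤ q v2 v2

lemma Nice.map {v1 v2 : E7} (h : Nice v1 v2) {g : E7 ≃ₗᵢ[ℝ] E7} (hg : InG g) :
    Nice (g v1) (g v2) := by
  obtain ⟨h11, h22, h12, q12, q13, q23, l12, l23⟩ := h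
  constructor <;> simp only [hg.cr, hg.q, g.inner_map_map] <;> assumption

lemma q_comm (u v : E7) : q u v = q v u := by unfold q; ring

lemma q_smul (u v : E7) (t : ℝ) : q u (t • v) = t * q u v := by
  simp [q]; ring

lemma exists_nice (P : Submodule ℝ E7) (hP : IsAssociative P) :
    ∃ v1 v2, Nice v1 v2 ∧ P = Submodule.span ℝ {v1, v2, cr v1 v2} := by
  obtain ⟨u1, u2, u3, ho, hphi, hPu⟩ := hP
  have n1 : inner ℝ u1 u1 = (1 : ℝ) := by have := ho.1 0; simp at this; simp [this]
  have n2 : inner ℝ u2 u2 = (1 : ℝ) := by have := ho.1 1; simp at this; simp [this]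
  have n3 : inner ℝ u3 u3 = (1 : ℝ) := by have := ho.1 2; simp at this; simp [this]
  have o12 : inner ℝ u1 u2 = (0 : ℝ) := by simpa using ho.2 (show (0 : Fin 3) ≠ 1 by decide)
  have o23 : inner ℝ u2 u3 = (0 : ℝ) := by simpa using ho.2 (show (1 : Fin 3) ≠ 2 by decide)
  have o31 : inner ℝ u3 u1 = (0 : ℝ) := by simpa using ho.2 (show (2 : Fin 3) ≠ 0 by decide)
  have c12 : cr u1 u2 = u3 := cr_eq_of n1 n2 n3 o12 hphi
  have c23 : cr u2 u3 = u1 := cr_eq_of n2 n3 n1 o23 (by rw [phi_cyc, hphi])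
  have c31 : cr u3 u1 = u2 := cr_eq_of n3 n1 n2 o31 (by rw [phi_cyc, phi_cyc, hphi])
  have hfr : Module.finrank ℝ P = 3 := by
    rw [hPu]
    have := finrank_span_eq_card (R := ℝ) ho.linearIndependent
    have hr : Set.range ![u1, u2, u3] = {u1, u2, u3} := by
      ext x; simp [eq_comm]; tauto
    rw [hr] at this
    simpa using this
  have hcl : ∀ x ∈ P, ∀ y ∈ P, cr x y ∈ P := by
    intro x hx y hy
    rw [hPu] at hx hy ⊢
    rw [Submodule.mem_span_triple] at hx hy ⊢
    obtain ⟨a, b, c, rfl⟩ := hx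
    obtain ⟨a', b', c', rfl⟩ := hy
    rw [cr_comb, c12, c23, c31]
    exact ⟨b * c' - c * b', c * a' - a * c', a * b' - b * a', by abel⟩
  let Dl : E7 →ₗ[ℝ] E7 :=
    { toFun := D
      map_add' := by intro x y; apply ext7 <;> simp [D]
      map_smul' := by intro x y; apply ext7 <;> simp [D] }
  let T : P →ₗ[ℝ] P := (P.orthogonalProjectionOnto : E7 →ₗ[ℝ] P) ∘ₗ Dl ∘ₗ P.subtype
  have hTq : ∀ x y : P, inner ℝ (T x) y = q x y := by
    intro x y
    rw [q_eq]
    exact Submodule.inner_orthogonalProjectionOnto_eq_of_mem_right y (D x)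
  have hT : T.IsSymmetric := by
    intro x y
    rw [hTq, real_inner_comm, hTq, q_comm]
  set b := hT.eigenvectorBasis hfr with hb
  set l := hT.eigenvalues hfr with hl
  have hanti : Antitone l := hT.eigenvalues_antitone hfr
  have hq : ∀ i j, q (b i) (b j) = if i = j then l i else 0 := by
    intro i j
    rw [← hTq, hT.apply_eigenvectorBasis hfr, real_inner_smul_left,
      orthonormal_iff_ite.1 b.orthonormal]
    simp [hl]
  have hin : ∀ i j, inner ℝ (b i : E7) (b j : E7) = if i = j then (1 : ℝ) else 0 := by
    intro i j
    rw [← Submodule.coe_inner, orthonormal_iff_ite.1 b.orthonormal]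
  set v1 : E7 := ((b 0 : P) : E7) with hv1
  set v2 : E7 := ((b 1 : P) : E7) with hv2
  have h11 : inner ℝ v1 v1 = (1 : ℝ) := by rw [hv1, hin]; simp
  have h22 : inner ℝ v2 v2 = (1 : ℝ) := by rw [hv2, hin]; simp
  have h12 : inner ℝ v1 v2 = (0 : ℝ) := by rw [hv1, hv2, hin]; simp
  have h3P : cr v1 v2 ∈ P := hcl _ (b 0).2 _ (b 1).2
  obtain ⟨t, ht⟩ : ∃ t : ℝ, cr v1 v2 = t • (b 2 : E7) := by
    have h := b.sum_repr' ⟨cr v1 v2, h3P⟩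
    have h' := congrArg (Subtype.val) h
    rw [Fin.sum_univ_three] at h'
    simp only [Submodule.coe_inner, Submodule.coe_add, Submodule.coe_smul] at h'
    rw [← hv1, ← hv2, cr_inner_left, cr_inner_right] at h'
    simp only [zero_smul, zero_add] at h'
    exact ⟨_, h'.symm⟩
  have ht2 : t * t = 1 := by
    have h := cr_inner v1 v2
    rw [h11, h22, h12, ht, real_inner_smul_left, real_inner_smul_right, hin] at h
    simpa using h
  refine ⟨v1, v2, ⟨h11, h22, h12, ?_, ?_, ?_, ?_, ?_⟩, ?_⟩
  · rw [hv1, hv2, hq]; simp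
  · rw [ht, q_smul, hv1, hq]; simp
  · rw [ht, q_smul, hv2, hq]; simp
  · rw [hv1, hv2, hq, hq]; simpa using hanti (show (0 : Fin 3) ≤ 1 by decide)
  · rw [ht, q_smul, q_comm, q_smul, hv2, hq, hq, ← mul_assoc, ht2]
    simpa using hanti (show (1 : Fin 3) ≤ 2 by decide)
  · apply le_antisymm
    · intro x hx
      have h := congrArg Subtype.val (b.sum_repr' ⟨x, hx⟩)
      rw [Fin.sum_univ_three] at h
      simp only [Submodule.coe_add, Submodule.coe_smul] at h
      rw [Submodule.mem_span_triple, ← h, ht]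
      refine ⟨inner ℝ (b 0) ⟨x, hx⟩, inner ℝ (b 1) ⟨x, hx⟩, inner ℝ (b 2) ⟨x, hx⟩ * t, ?_⟩
      rw [smul_smul, mul_assoc, ht2, mul_one]
    · rw [Submodule.span_le]
      rintro x (rfl | rfl | rfl)
      · exact (b 0).2
      · exact (b 1).2
      · exact h3P

lemma exists_frame (x y z x' y' z' c c' : ℝ) (hc : 0 ≤ c') (hcc : c' ≤ c)
    (h1 : x ^ 2 + y ^ 2 + z ^ 2 = c ^ 2) (h2 : x' ^ 2 + y' ^ 2 + z' ^ 2 = c' ^ 2)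
    (h3 : x * x' + y * y' + z * z' = 0) : ∃ a b d a' b' d' : ℝ,
    a ^ 2 + b ^ 2 + d ^ 2 = 1 ∧ a' ^ 2 + b' ^ 2 + d' ^ 2 = 1 ∧ a * a' + b * b' + d * d' = 0 ∧
    x = c * a ∧ y = c * b ∧ z = c * d ∧ x' = c' * a' ∧ y' = c' * b' ∧ z' = c' * d' := by
  have zero : ∀ x y z : ℝ, x ^ 2 + y ^ 2 + z ^ 2 = 0 → x = 0 ∧ y = 0 ∧ z = 0 := by
    intro x y z h
    refine ⟨?_, ?_, ?_⟩ <;> nlinarith [sq_nonneg x, sq_nonneg y, sq_nonneg z]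
  by_cases hc0 : c = 0
  · have hc0' : c' = 0 := by linarith
    subst hc0 hc0'
    obtain ⟨rfl, rfl, rfl⟩ := zero x y z (by simpa using h1)
    obtain ⟨rfl, rfl, rfl⟩ := zero x' y' z' (by simpa using h2)
    exact ⟨1, 0, 0, 0, 1, 0, by norm_num, by norm_num, by norm_num, by norm_num, by norm_num,
      by norm_num, by norm_num, by norm_num, by norm_num⟩
  obtain ⟨a, rfl⟩ : ∃ a, x = c * a := ⟨x / c, by field_simp⟩
  obtain ⟨b, rfl⟩ : ∃ a, y = c * a := ⟨y / c, by field_simp⟩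
  obtain ⟨d, rfl⟩ : ∃ a, z = c * a := ⟨z / c, by field_simp⟩
  have k1 : a ^ 2 + b ^ 2 + d ^ 2 = 1 := by
    have : c ^ 2 * (a ^ 2 + b ^ 2 + d ^ 2) = c ^ 2 * 1 := by linarith
    exact mul_left_cancel₀ (pow_ne_zero 2 hc0) this
  by_cases hc0' : c' = 0
  · subst hc0'
    obtain ⟨rfl, rfl, rfl⟩ := zero x' y' z' (by simpa using h2)
    by_cases hab : a ^ 2 + b ^ 2 = 0
    · have ha : a = 0 := by nlinarith [sq_nonneg a, sq_nonneg b]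
      have hb : b = 0 := by nlinarith [sq_nonneg a, sq_nonneg b]
      exact ⟨a, b, d, 1, 0, 0, k1, by norm_num, by simp [ha], rfl, rfl, rfl, by simp, by simp,
        by simp⟩
    · have hpos : 0 < a ^ 2 + b ^ 2 := lt_of_le_of_ne (by positivity) (Ne.symm hab)
      have hs : √(a ^ 2 + b ^ 2) ^ 2 = a ^ 2 + b ^ 2 := Real.sq_sqrt hpos.le
      have hs0 : √(a ^ 2 + b ^ 2) ≠ 0 := (Real.sqrt_pos.2 hpos).ne'
      refine ⟨a, b, d, -b / √(a ^ 2 + b ^ 2), a / √(a ^ 2 + b ^ 2), 0, k1, ?_, ?_, rfl, rfl, rfl,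
        by simp, by simp, by simp⟩
      · rw [div_pow, div_pow, hs]; field_simp; ring
      · field_simp; ring
  obtain ⟨a', rfl⟩ : ∃ a, x' = c' * a := ⟨x' / c', by field_simp⟩
  obtain ⟨b', rfl⟩ : ∃ a, y' = c' * a := ⟨y' / c', by field_simp⟩
  obtain ⟨d', rfl⟩ : ∃ a, z' = c' * a := ⟨z' / c', by field_simp⟩
  refine ⟨a, b, d, a', b', d', k1, ?_, ?_, rfl, rfl, rfl, rfl, rfl, rfl⟩
  · have : c' ^ 2 * (a' ^ 2 + b' ^ 2 + d' ^ 2) = c' ^ 2 * 1 := by linarith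
    exact mul_left_cancel₀ (pow_ne_zero 2 hc0') this
  · have : (c * c') * (a * a' + b * b' + d * d') = (c * c') * 0 := by linarith
    exact mul_left_cancel₀ (mul_ne_zero hc0 hc0') this

lemma sq4_zero (a b c d : ℝ) (h : a * a + b * b + c * c + d * d = 0) :
    a = 0 ∧ b = 0 ∧ c = 0 ∧ d = 0 := by
  have ha := mul_self_nonneg a
  have hb := mul_self_nonneg b
  have hc := mul_self_nonneg c
  have hd := mul_self_nonneg d
  exact ⟨mul_self_eq_zero.1 (by linarith), mul_self_eq_zero.1 (by linarith),
    mul_self_eq_zero.1 (by linarith), mul_self_eq_zero.1 (by linarith)⟩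

set_option maxHeartbeats 1000000 in
lemma normal_step2 (v1 v2 : E7) (h : Nice v1 v2) (c c' : ℝ) (hc : 0 ≤ c') (hcc : c' ≤ c)
    (a0 : v1 0 = c) (a1 : v1 1 = 0) (a2 : v1 2 = 0)
    (b0 : v2 0 = 0) (b1 : v2 1 = c') (b2 : v2 2 = 0) :
    ∃ (g : E7 ≃ₗᵢ[ℝ] E7) (s r : ℝ), InG g ∧ 0 ≤ s ∧ 3 * s ≤ r ∧ r ≤ π / 2 ∧
      g v1 = w1 s r ∧ g v2 = w2 s r := by
  have i1 := h.h11
  have i2 := h.h22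
  rw [inner7, a0, a1, a2] at i1
  rw [inner7, b0, b1, b2] at i2
  have hc1 : c ≤ 1 := by
    nlinarith [sq_nonneg (v1 3), sq_nonneg (v1 4), sq_nonneg (v1 5), sq_nonneg (v1 6)]
  obtain ⟨α, hα⟩ : ∃ α, α = arccos c := ⟨_, rfl⟩
  obtain ⟨β, hβ⟩ : ∃ β, β = arccos c' := ⟨_, rfl⟩
  have α0 : 0 ≤ α := hα ▸ arccos_nonneg c
  have αβ : α ≤ β := by rw [hα, hβ]; exact Real.arccos_le_arccos hcc
  have β1 : β ≤ π / 2 := by rw [hβ]; exact Real.arccos_le_pi_div_two.2 hc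
  have hπ := Real.pi_pos
  have cα : cos α = c := by rw [hα]; exact Real.cos_arccos (by linarith) hc1
  have cβ : cos β = c' := by rw [hβ]; exact Real.cos_arccos (by linarith) (by linarith)
  have sα := Real.sin_sq_add_cos_sq α
  have sβ := Real.sin_sq_add_cos_sq β
  have sα0 : 0 ≤ sin α := Real.sin_nonneg_of_nonneg_of_le_pi α0 (by linarith)
  have sβ0 : 0 ≤ sin β := Real.sin_nonneg_of_nonneg_of_le_pi (by linarith) (by linarith)
  rw [← cα] at i1 a0
  rw [← cβ] at i2 b1
  clear hα hβ
  subst cα cβ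
  rcases α0.eq_or_lt with h0 | hpos
  · subst h0
    simp only [Real.cos_zero, Real.sin_zero] at *
    have hA : v1 ∈ A := by
      rw [mem_A]
      exact sq4_zero _ _ _ _ (by linarith)
    obtain ⟨g, hg, hg0, hg1⟩ := exists_M ![v2 3, v2 4, v2 5, v2 6] ![0, - sin β, 0, 0] (by
      simp; linarith)
    have gA := hg.mem hA
    rw [mem_A] at gA
    obtain ⟨g3, g4, g5, g6⟩ := gA
    obtain ⟨k0, k1, k2⟩ := hg0 v1
    obtain ⟨l0, l1, l2⟩ := hg0 v2
    obtain ⟨l3, l4, l5, l6⟩ := hg1 v2 rfl rfl rfl rfl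
    refine ⟨g, 0, β, hg, le_rfl, by linarith, β1, ?_, ?_⟩
    · apply ext7 <;> simp [w1, e_apply, *]
    · simp at l3 l4 l5 l6
      apply ext7 <;> simp [w2, e_apply, *]
  · have sαpos : 0 < sin α := Real.sin_pos_of_pos_of_lt_pi hpos (by linarith)
    obtain ⟨g, hg, hg0, hg1⟩ := exists_M ![v1 3, v1 4, v1 5, v1 6] ![0, 0, sin α, 0] (by
      simp; linarith)
    obtain ⟨k0, k1, k2⟩ := hg0 v1
    obtain ⟨l0, l1, l2⟩ := hg0 v2
    obtain ⟨k3, k4, k5, k6⟩ := hg1 v1 rfl rfl rfl rfl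
    simp at k3 k4 k5 k6
    rw [a0] at k0
    rw [a1] at k1
    rw [a2] at k2
    rw [b0] at l0
    rw [b1] at l1
    rw [b2] at l2
    have hN := h.map hg
    clear i1 i2
    obtain ⟨-, i2, i12, -, q13, q23, -, l23⟩ := hN
    simp only [inner7, q, cr0, cr1, cr2, k0, k1, k2, k3, k4, k5, k6, l0, l1, l2] at i2 i12 q13 q23 l23
    set x := g v2 3
    set y := g v2 4
    set z := g v2 5
    set t := g v2 6
    have hz : z = 0 := by
      have : sin α * z = 0 := by linarith
      exact (mul_eq_zero.1 this).resolve_left sαpos.ne'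
    have hxt : x = 0 ∧ t = 0 := by
      rcases hc.eq_or_lt with hc0 | hcp
      · rw [← hc0] at l23
        have e0 : (sin α * x) * (sin α * x) + (sin α * t) * (sin α * t)
            + (sin α * y) * (sin α * y) + 0 * 0 ≤ 0 := by linarith
        obtain ⟨e2, e3, -, -⟩ := sq4_zero _ _ _ _ (le_antisymm e0 (by
          linarith [mul_self_nonneg (sin α * x), mul_self_nonneg (sin α * t),
            mul_self_nonneg (sin α * y)]))
        exact ⟨(mul_eq_zero.1 e2).resolve_left sαpos.ne', (mul_eq_zero.1 e3).resolve_left sαpos.ne'⟩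
      · have e2 : (cos β * sin α) * x = 0 := by linarith
        have e3 : (cos α * sin α) * t = 0 := by linarith
        exact ⟨(mul_eq_zero.1 e2).resolve_left (by positivity),
          (mul_eq_zero.1 e3).resolve_left (mul_pos (by linarith) sαpos).ne'⟩
    obtain ⟨hx, ht⟩ := hxt
    rw [hx, hz, ht] at i2 l23
    have hy : y = - sin β := by
      have : (y - sin β) * (y + sin β) = 0 := by linarith
      rcases mul_eq_zero.1 this with h1 | h1
      · exfalso
        have hy : y = sin β := by linarith
        rw [hy] at l23
        have e1 : cos (β - α) ^ 2 ≤ cos β ^ 2 := by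
          rw [Real.cos_sub]; linarith
        have e2 : cos β < cos (β - α) :=
          Real.cos_lt_cos_of_nonneg_of_le_pi (by linarith) (by linarith) (by linarith)
        nlinarith
      · linarith
    have e1 : cos (α + β) ^ 2 ≤ cos β ^ 2 := by
      rw [hy] at l23
      rw [Real.cos_add]; linarith
    refine ⟨g, α / 2, β + α / 2, hg, by linarith, by linarith, ?_, ?_, ?_⟩
    · by_contra hcon
      have e2 : sin (α + 2 * β) < 0 := by
        have := Real.sin_pos_of_pos_of_lt_pi (x := α + 2 * β - π) (by linarith) (by linarith)
        rw [Real.sin_sub_pi] at this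
        linarith
      have e3 : sin (α + 2 * β) * sin α = cos β ^ 2 - cos (α + β) ^ 2 := by
        rw [Real.sin_add, Real.sin_two_mul, Real.cos_two_mul, Real.cos_add]
        linear_combination (-cos β ^ 2 + sin β ^ 2) * sα - (1 - 2 * cos β ^ 2) * sα + (sin α ^ 2) * sβ
          + (1 - sin β ^ 2) * sα
      nlinarith
    · have e2 : 2 * (α / 2) = α := by ring
      apply ext7 <;> simp [w1, e_apply, e2, *]
    · have e2 : α / 2 - (β + α / 2) = - β := by ring
      have hx' : g v2 3 = 0 := hx
      have hy' : g v2 4 = - sin β := hy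
      have hz' : g v2 5 = 0 := hz
      have ht' : g v2 6 = 0 := ht
      apply ext7 <;> simp [w2, e_apply, e2, *]

lemma normal_step1 (v1 v2 : E7) (h : Nice v1 v2) :
    ∃ (g : E7 ≃ₗᵢ[ℝ] E7) (s r : ℝ), InG g ∧ 0 ≤ s ∧ 3 * s ≤ r ∧ r ≤ π / 2 ∧
      g v1 = w1 s r ∧ g v2 = w2 s r := by
  have nn : ∀ v : E7, 0 ≤ q v v := fun v => by
    unfold q; nlinarith [mul_self_nonneg (v 0), mul_self_nonneg (v 1), mul_self_nonneg (v 2)]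
  have s1 : √(q v1 v1) ^ 2 = q v1 v1 := Real.sq_sqrt (nn v1)
  have s2 : √(q v2 v2) ^ 2 = q v2 v2 := Real.sq_sqrt (nn v2)
  obtain ⟨a, b, d, a', b', d', n1, n2, n12, x1, x2, x3, y1, y2, y3⟩ :=
    exists_frame (v1 0) (v1 1) (v1 2) (v2 0) (v2 1) (v2 2) (√(q v1 v1)) (√(q v2 v2))
      (Real.sqrt_nonneg _) (Real.sqrt_le_sqrt h.l12) (by rw [s1]; unfold q; ring)
      (by rw [s2]; unfold q; ring) h.q12
  obtain ⟨g, hg, hgu⟩ := exists_R a b d a' b' d' n1 n2 n12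
  obtain ⟨k0, k1, k2⟩ := hgu v1
  obtain ⟨l0, l1, l2⟩ := hgu v2
  obtain ⟨g', s, r, hg', hs, hsr, hr, hw1, hw2⟩ := normal_step2 (g v1) (g v2) (h.map hg)
    (√(q v1 v1)) (√(q v2 v2)) (Real.sqrt_nonneg _) (Real.sqrt_le_sqrt h.l12)
    (by rw [k0, x1, x2, x3]; linear_combination (√(q v1 v1)) * n1)
    (by rw [k1, x1, x2, x3]; linear_combination (√(q v1 v1)) * n12)
    (by rw [k2, x1, x2, x3]; ring)
    (by rw [l0, y1, y2, y3]; linear_combination (√(q v2 v2)) * n12)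
    (by rw [l1, y1, y2, y3]; linear_combination (√(q v2 v2)) * n2)
    (by rw [l2, y1, y2, y3]; ring)
  exact ⟨g.trans g', s, r, hg.trans hg', hs, hsr, hr, hw1, hw2⟩

lemma cr_w (s r : ℝ) : cr (w1 s r) (w2 s r) = w3 s r := by
  have e1 : cos (s + r) = cos (2 * s) * cos (s - r) + sin (2 * s) * sin (s - r) := by
    rw [← Real.cos_sub]; congr 1; ring
  have e2 : sin (s + r) = sin (2 * s) * cos (s - r) - cos (2 * s) * sin (s - r) := by
    rw [← Real.sin_sub]; congr 1; ring
  apply ext7 <;> simp [cr0, cr1, cr2, cr3, cr4, cr5, cr6, w1, w2, w3, e_apply, e1, e2] <;> ring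

lemma existence (P : Submodule ℝ E7) (hP : IsAssociative P) :
    ∃ (g : E7 ≃ₗᵢ[ℝ] E7) (s r : ℝ),
      (∀ u v w : E7, phi0 (g u) (g v) (g w) = phi0 u v w) ∧
      Submodule.map (g.toLinearEquiv : E7 →ₗ[ℝ] E7) A = A ∧
      0 ≤ s ∧ 3 * s ≤ r ∧ r ≤ π / 2 ∧
      Submodule.map (g.toLinearEquiv : E7 →ₗ[ℝ] E7) P = Psr s r := by
  obtain ⟨v1, v2, hN, rfl⟩ := exists_nice P hP
  obtain ⟨g, s, r, hg, hs, hsr, hr, h1, h2⟩ := normal_step1 v1 v2 hN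
  refine ⟨g, s, r, hg.1, hg.2, hs, hsr, hr, ?_⟩
  have h3 : g (cr v1 v2) = w3 s r := by rw [← hg.cr, h1, h2, cr_w]
  rw [Submodule.map_span, Set.image_insert_eq, Set.image_insert_eq, Set.image_singleton]
  simp [Psr, h1, h2, h3]

lemma w_inner (s r x y z x' y' z' : ℝ) :
    inner ℝ (x • w1 s r + y • w2 s r + z • w3 s r) (x' • w1 s r + y' • w2 s r + z' • w3 s r)
      = x * x' + y * y' + z * z' := by
  rw [inner7]
  simp [w1, w2, w3, e_apply]
  linear_combination x * x' * Real.sin_sq_add_cos_sq (2 * s)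
    + y * y' * Real.sin_sq_add_cos_sq (s - r) + z * z' * Real.sin_sq_add_cos_sq (s + r)

lemma w_q (s r x y z : ℝ) :
    q (x • w1 s r + y • w2 s r + z • w3 s r) (x • w1 s r + y • w2 s r + z • w3 s r)
      = x ^ 2 * cos (2 * s) ^ 2 + y ^ 2 * cos (s - r) ^ 2 + z ^ 2 * cos (s + r) ^ 2 := by
  simp [q, w1, w2, w3, e_apply]
  ring

lemma uniq_aux (h : E7 ≃ₗᵢ[ℝ] E7) (hh : InG h) (s r s' r' : ℝ) 
    (hs' : 0 ≤ s') (hsr' : 3 * s' ≤ r') (hr' : r' ≤ π / 2)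
    (hm : Submodule.map (h.toLinearEquiv : E7 →ₗ[ℝ] E7) (Psr s r) = Psr s' r') :
    cos (2 * s) ^ 2 ≤ cos (2 * s') ^ 2 ∧ 
    cos (2 * s) ^ 2 + cos (s - r) ^ 2 + cos (s + r) ^ 2 =
      cos (2 * s') ^ 2 + cos (s' - r') ^ 2 + cos (s' + r') ^ 2 := by
  have hπ := Real.pi_pos
  have key : ∀ x y z : ℝ, ∃ a b c : ℝ,
      a • w1 s' r' + b • w2 s' r' + c • w3 s' r' = h (x • w1 s r + y • w2 s r + z • w3 s r) := by
    intro x y z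
    have : h (x • w1 s r + y • w2 s r + z • w3 s r) ∈ Psr s' r' := by
      rw [← hm]
      exact ⟨_, Submodule.mem_span_triple.2 ⟨x, y, z, rfl⟩, rfl⟩
    exact Submodule.mem_span_triple.1 this
  obtain ⟨a1, b1, c1, k1⟩ := key 1 0 0
  obtain ⟨a2, b2, c2, k2⟩ := key 0 1 0
  obtain ⟨a3, b3, c3, k3⟩ := key 0 0 1
  have q1 := hh.q ((1 : ℝ) • w1 s r + (0 : ℝ) • w2 s r + (0 : ℝ) • w3 s r)
    ((1 : ℝ) • w1 s r + (0 : ℝ) • w2 s r + (0 : ℝ) • w3 s r)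
  have q2 := hh.q ((0 : ℝ) • w1 s r + (1 : ℝ) • w2 s r + (0 : ℝ) • w3 s r)
    ((0 : ℝ) • w1 s r + (1 : ℝ) • w2 s r + (0 : ℝ) • w3 s r)
  have q3 := hh.q ((0 : ℝ) • w1 s r + (0 : ℝ) • w2 s r + (1 : ℝ) • w3 s r)
    ((0 : ℝ) • w1 s r + (0 : ℝ) • w2 s r + (1 : ℝ) • w3 s r)
  rw [w_q, ← k1, w_q] at q1
  rw [w_q, ← k2, w_q] at q2
  rw [w_q, ← k3, w_q] at q3
  have i : ∀ x y, inner ℝ (h x) (h y) = inner ℝ x y := h.inner_map_map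
  have i11 := i (((1 : ℝ) • w1 s r + (0 : ℝ) • w2 s r + (0 : ℝ) • w3 s r)) ((1 : ℝ) • w1 s r + (0 : ℝ) • w2 s r + (0 : ℝ) • w3 s r)
  have i22 := i (((0 : ℝ) • w1 s r + (1 : ℝ) • w2 s r + (0 : ℝ) • w3 s r)) ((0 : ℝ) • w1 s r + (1 : ℝ) • w2 s r + (0 : ℝ) • w3 s r)
  have i33 := i (((0 : ℝ) • w1 s r + (0 : ℝ) • w2 s r + (1 : ℝ) • w3 s r)) ((0 : ℝ) • w1 s r + (0 : ℝ) • w2 s r + (1 : ℝ) • w3 s r)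
  have i12 := i (((1 : ℝ) • w1 s r + (0 : ℝ) • w2 s r + (0 : ℝ) • w3 s r)) ((0 : ℝ) • w1 s r + (1 : ℝ) • w2 s r + (0 : ℝ) • w3 s r)
  have i13 := i (((1 : ℝ) • w1 s r + (0 : ℝ) • w2 s r + (0 : ℝ) • w3 s r)) ((0 : ℝ) • w1 s r + (0 : ℝ) • w2 s r + (1 : ℝ) • w3 s r)
  have i23 := i (((0 : ℝ) • w1 s r + (1 : ℝ) • w2 s r + (0 : ℝ) • w3 s r)) ((0 : ℝ) • w1 s r + (0 : ℝ) • w2 s r + (1 : ℝ) • w3 s r)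
  rw [w_inner, ← k1, w_inner] at i11
  rw [w_inner, ← k2, w_inner] at i22
  rw [w_inner, ← k3, w_inner] at i33
  rw [w_inner, ← k1, ← k2, w_inner] at i12
  rw [w_inner, ← k1, ← k3, w_inner] at i13
  rw [w_inner, ← k2, ← k3, w_inner] at i23
  have hM : !![a1, b1, c1; a2, b2, c2; a3, b3, c3] * (!![a1, b1, c1; a2, b2, c2; a3, b3, c3]).transpose = 1 := by
    ext i j
    fin_cases i <;> fin_cases j <;> simp [Matrix.mul_apply, Fin.sum_univ_three] <;> linarith
  have hM2 := mul_eq_one_comm.1 hM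
  have M00 := congrFun (congrFun hM2 0) 0
  have M11 := congrFun (congrFun hM2 1) 1
  have M22 := congrFun (congrFun hM2 2) 2
  simp [Matrix.mul_apply, Fin.sum_univ_three] at M00 M11 M22
  have o1 : cos (s' - r') ^ 2 ≤ cos (2 * s') ^ 2 := by
    have e1 : cos (r' - s') ≤ cos (2 * s') :=
      Real.cos_le_cos_of_nonneg_of_le_pi (by linarith) (by linarith) (by linarith)
    have e2 : 0 ≤ cos (r' - s') := Real.cos_nonneg_of_mem_Icc ⟨by linarith, by linarith⟩
    rw [← Real.cos_neg (s' - r'), neg_sub]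
    exact pow_le_pow_left₀ e2 e1 2
  have o2 : cos (s' + r') ^ 2 ≤ cos (2 * s') ^ 2 := by
    have e1 : cos (s' + r') ≤ cos (2 * s') :=
      Real.cos_le_cos_of_nonneg_of_le_pi (by linarith) (by linarith) (by linarith)
    have e2 : cos (π - (s' + r')) ≤ cos (2 * s') :=
      Real.cos_le_cos_of_nonneg_of_le_pi (by linarith) (by linarith) (by linarith)
    rw [Real.cos_pi_sub] at e2
    exact sq_le_sq' (by linarith) e1
  constructor
  · nlinarith [mul_le_mul_of_nonneg_left o1 (sq_nonneg b1), mul_le_mul_of_nonneg_left o2 (sq_nonneg c1)]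
  · linear_combination - q1 - q2 - q3 + cos (2 * s') ^ 2 * M00 + cos (s' - r') ^ 2 * M11
      + cos (s' + r') ^ 2 * M22

lemma uniqueness (h : E7 ≃ₗᵢ[ℝ] E7) (hh : InG h) (s r s' r' : ℝ)
    (hs : 0 ≤ s) (hsr : 3 * s ≤ r) (hr : r ≤ π / 2)
    (hs' : 0 ≤ s') (hsr' : 3 * s' ≤ r') (hr' : r' ≤ π / 2)
    (hm : Submodule.map (h.toLinearEquiv : E7 →ₗ[ℝ] E7) (Psr s r) = Psr s' r') :
    s = s' ∧ r = r' := by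
  have hπ := Real.pi_pos
  obtain ⟨l1, t1⟩ := uniq_aux h hh s r s' r' hs' hsr' hr' hm
  obtain ⟨l2, -⟩ := uniq_aux h.symm hh.symm s' r' s r hs hsr hr (map_symm_of hm)
  have p1 : 0 < cos (2 * s) := Real.cos_pos_of_mem_Ioo ⟨by linarith, by linarith⟩
  have p2 : 0 < cos (2 * s') := Real.cos_pos_of_mem_Ioo ⟨by linarith, by linarith⟩
  have e1 : cos (2 * s) = cos (2 * s') :=
    (pow_left_inj₀ p1.le p2.le two_ne_zero).1 (le_antisymm l1 l2)
  have e2 : 2 * s = 2 * s' := Real.injOn_cos ⟨by linarith, by linarith⟩ ⟨by linarith, by linarith⟩ e1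
  have e3 : s = s' := by linarith
  subst e3
  refine ⟨rfl, ?_⟩
  have tr : ∀ r, cos (s - r) ^ 2 + cos (s + r) ^ 2 = 1 + cos (2 * s) * cos (2 * r) := by
    intro r
    rw [Real.cos_sub, Real.cos_add, Real.cos_two_mul, Real.cos_two_mul]
    have h1 := Real.sin_sq_add_cos_sq s
    have h2 := Real.sin_sq_add_cos_sq r
    have h3 : sin s ^ 2 = 1 - cos s ^ 2 := by linarith
    have h4 : sin r ^ 2 = 1 - cos r ^ 2 := by linarith
    ring_nf
    rw [h3, h4]
    ring
  have t2 := tr r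
  have t3 := tr r'
  have e4 : cos (2 * s) * cos (2 * r) = cos (2 * s) * cos (2 * r') := by linarith
  have e5 := mul_left_cancel₀ p1.ne' e4
  have e6 : 2 * r = 2 * r' := Real.injOn_cos ⟨by linarith, by linarith⟩ ⟨by linarith, by linarith⟩ e5
  linarith

/-- Normal form for associative 3-planes under the SO(4)-action (existence and uniqueness of
the angles (s,r)). -/
theorem statement0 (P : Submodule ℝ E7) (hP : IsAssociative P) :
    (∃ (g : E7 ≃ₗᵢ[ℝ] E7) (s r : ℝ),
      (∀ u v w : E7, phi0 (g u) (g v) (g w) = phi0 u v w) ∧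
      Submodule.map (g.toLinearEquiv : E7 →ₗ[ℝ] E7) A = A ∧
      0 ≤ s ∧ 3 * s ≤ r ∧ r ≤ π / 2 ∧
      Submodule.map (g.toLinearEquiv : E7 →ₗ[ℝ] E7) P = Psr s r) ∧
    (∀ (g g' : E7 ≃ₗᵢ[ℝ] E7) (s r s' r' : ℝ),
      (∀ u v w : E7, phi0 (g u) (g v) (g w) = phi0 u v w) →
      Submodule.map (g.toLinearEquiv : E7 →ₗ[ℝ] E7) A = A →
      (∀ u v w : E7, phi0 (g' u) (g' v) (g' w) = phi0 u v w) →
      Submodule.map (g'.toLinearEquiv : E7 →ₗ[ℝ] E7) A = A →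
      0 ≤ s → 3 * s ≤ r → r ≤ π / 2 →
      0 ≤ s' → 3 * s' ≤ r' → r' ≤ π / 2 →
      Submodule.map (g.toLinearEquiv : E7 →ₗ[ℝ] E7) P = Psr s r →
      Submodule.map (g'.toLinearEquiv : E7 →ₗ[ℝ] E7) P = Psr s' r' →
      s = s' ∧ r = r') := by
  refine ⟨existence P hP, ?_⟩
  intro g g' s r s' r' g1 g2 g1' g2' hs hsr hr hs' hsr' hr' hm hm'
  have hg : InG g := ⟨g1, g2⟩
  have hg' : InG g' := ⟨g1', g2'⟩
  refine uniqueness (g.symm.trans g') (hg.symm.trans hg') s r s' r' hs hsr hr hs' hsr' hr' ?_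
  rw [← hm', ← map_symm_of hm, ← Submodule.map_comp]
  rfl
end
end

section
/- For all γ₁, γ₂, γ₃ ∈ ℝ, the three vectors v₁ = cos(γ₁)e₁ + sin(γ₁)e₆, v₂ = cos(γ₂)e₂ − sin(γ₂)e₅, v₃ = cos(γ₃)e₃ − sin(γ₃)e₄ are orthonormal and satisfy φ₀(v₁, v₂, v₃) = cos(γ₁ + γ₂ + γ₃). Consequently, span(v₁, v₂, v₃) is an associative 3-plane if and only if γ₁ + γ₂ + γ₃ is an integer multiple of π. -/
open Real

noncomputable section

lemma inner_e (i j : Fin 7) : inner ℝ (e i) (e j) = if i = j then (1 : ℝ) else 0 := by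
  have h := orthonormal_iff_ite.1 (EuclideanSpace.basisFun (Fin 7) ℝ).orthonormal i j
  simpa only [e, EuclideanSpace.basisFun_apply] using h

lemma trip_comb (i j k : Fin 7) (v : Fin 3 → E7) (M : Matrix (Fin 3) (Fin 3) ℝ) :
    trip i j k (∑ a, M 0 a • v a) (∑ a, M 1 a • v a) (∑ a, M 2 a • v a)
      = M.det * trip i j k (v 0) (v 1) (v 2) := by
  simp [trip, Matrix.det_fin_three, Fin.sum_univ_three]
  ring

lemma phi0_comb (v : Fin 3 → E7) (M : Matrix (Fin 3) (Fin 3) ℝ) :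
    phi0 (∑ a, M 0 a • v a) (∑ a, M 1 a • v a) (∑ a, M 2 a • v a)
      = M.det * phi0 (v 0) (v 1) (v 2) := by
  simp only [phi0, trip_comb]
  ring

lemma phi0_sq_of_span (u v : Fin 3 → E7) (hu : Orthonormal ℝ u) (hv : Orthonormal ℝ v)
    (h : ∀ i, u i ∈ Submodule.span ℝ (Set.range v)) :
    phi0 (u 0) (u 1) (u 2) ^ 2 = phi0 (v 0) (v 1) (v 2) ^ 2 := by
  have h' : ∀ i, ∃ c : Fin 3 → ℝ, ∑ a, c a • v a = u i := fun i =>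
    (Submodule.mem_span_range_iff_exists_fun ℝ).1 (h i)
  choose c hc using h'
  have hM : (Matrix.of c) * (Matrix.of c).transpose = 1 := by
    ext i j
    have h1 := (orthonormal_iff_ite.1 hu) i j
    rw [← hc i, ← hc j, hv.inner_sum] at h1
    simpa [Matrix.mul_apply, Matrix.one_apply] using h1
  have hd : (Matrix.of c).det ^ 2 = 1 := by
    have := congrArg Matrix.det hM
    rw [Matrix.det_mul, Matrix.det_transpose, Matrix.det_one] at this
    rw [sq, this]
  have := phi0_comb v (Matrix.of c)
  simp only [Matrix.of_apply, hc] at this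
  rw [this, mul_pow, hd, one_mul]

/-- The key computation behind the normal-form proposition: the triple
(cos γ₁ e₁ + sin γ₁ e₆, cos γ₂ e₂ − sin γ₂ e₅, cos γ₃ e₃ − sin γ₃ e₄) is orthonormal,
φ₀ evaluates on it to cos(γ₁+γ₂+γ₃), and its span is associative iff γ₁+γ₂+γ₃ ∈ πℤ. -/
theorem statement1 (γ₁ γ₂ γ₃ : ℝ) :
    let v₁ : E7 := Real.cos γ₁ • e 0 + Real.sin γ₁ • e 5
    let v₂ : E7 := Real.cos γ₂ • e 1 - Real.sin γ₂ • e 4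
    let v₃ : E7 := Real.cos γ₃ • e 2 - Real.sin γ₃ • e 3
    Orthonormal ℝ ![v₁, v₂, v₃] ∧
      phi0 v₁ v₂ v₃ = Real.cos (γ₁ + γ₂ + γ₃) ∧
      (IsAssociative (Submodule.span ℝ {v₁, v₂, v₃}) ↔
        ∃ n : ℤ, γ₁ + γ₂ + γ₃ = n * π) := by
  intro v₁ v₂ v₃
  have hon : Orthonormal ℝ ![v₁, v₂, v₃] := by
    have h1 := Real.sin_sq_add_cos_sq γ₁
    have h2 := Real.sin_sq_add_cos_sq γ₂
    have h3 := Real.sin_sq_add_cos_sq γ₃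
    rw [orthonormal_iff_ite]
    intro i j
    fin_cases i <;> fin_cases j <;>
      simp [v₁, v₂, v₃, inner_e, inner_add_left, inner_add_right, inner_sub_left,
        inner_sub_right, inner_smul_left, inner_smul_right, Fin.ext_iff,
        -inner_self_eq_norm_sq_to_K] <;>
      linarith
  have hphi : phi0 v₁ v₂ v₃ = Real.cos (γ₁ + γ₂ + γ₃) := by
    simp [phi0, trip, v₁, v₂, v₃, e, Matrix.det_fin_three, Fin.ext_iff, Pi.single_apply,
      Real.cos_add, Real.sin_add]
    ring
  refine ⟨hon, hphi, ?_, ?_⟩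
  · rintro ⟨u₁, u₂, u₃, hu, h1, hs⟩
    have hr : Set.range ![v₁, v₂, v₃] = {v₁, v₂, v₃} := by
      ext x
      simp
      tauto
    have key := phi0_sq_of_span ![u₁, u₂, u₃] ![v₁, v₂, v₃] hu hon (by
      intro i
      rw [hr, hs]
      apply Submodule.subset_span
      fin_cases i <;> simp)
    have key' : phi0 u₁ u₂ u₃ ^ 2 = phi0 v₁ v₂ v₃ ^ 2 := key
    rw [h1, hphi] at key'
    have hsin : Real.sin (γ₁ + γ₂ + γ₃) = 0 := by
      have := Real.sin_sq_add_cos_sq (γ₁ + γ₂ + γ₃)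
      have h0 : Real.sin (γ₁ + γ₂ + γ₃) ^ 2 = 0 := by linarith
      exact pow_eq_zero_iff (two_ne_zero) |>.1 h0
    obtain ⟨n, hn⟩ := Real.sin_eq_zero_iff.1 hsin
    exact ⟨n, hn.symm⟩
  · rintro ⟨n, hn⟩
    have hsin : Real.sin (γ₁ + γ₂ + γ₃) = 0 := by rw [hn]; exact Real.sin_int_mul_pi n
    rcases Real.sin_eq_zero_iff_cos_eq.1 hsin with hc | hc
    · exact ⟨v₁, v₂, v₃, hon, hphi.trans hc, rfl⟩
    · refine ⟨v₂, v₁, v₃, ?_, ?_, by rw [Set.insert_comm]⟩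
      · have := hon.comp ![1, 0, 2] (by decide)
        convert this using 1
        ext i
        fin_cases i <;> rfl
      · have hsw : phi0 v₂ v₁ v₃ = - phi0 v₁ v₂ v₃ := by
          simp only [phi0, trip, Matrix.det_fin_three]
          simp
          ring
        rw [hsw, hphi, hc, neg_neg]
end
end

section
/- For all s, r ∈ ℝ, the three vectors w₁ = cos(2s)e₁ + sin(2s)e₆, w₂ = cos(s−r)e₂ + sin(s−r)e₅, w₃ = cos(s+r)e₃ + sin(s+r)e₄ are orthonormal and satisfy φ₀(w₁, w₂, w₃) = 1. In particular, P_{s,r} = span(w₁, w₂, w₃) is an associative 3-plane for every s, r ∈ ℝ. -/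
open Real

noncomputable section

/-- For all s, r the triple spanning P_{s,r} is orthonormal with φ₀ = 1; hence P_{s,r} is an
associative 3-plane. -/
theorem statement2 (s r : ℝ) :
    Orthonormal ℝ ![w1 s r, w2 s r, w3 s r] ∧
      phi0 (w1 s r) (w2 s r) (w3 s r) = 1 ∧
      IsAssociative (Psr s r) := by
  have horth : Orthonormal ℝ ![w1 s r, w2 s r, w3 s r] := by
    rw [orthonormal_iff_ite]
    have h1 := Real.cos_sq_add_sin_sq (2 * s)
    have h2 := Real.cos_sq_add_sin_sq (s - r)
    have h3 := Real.cos_sq_add_sin_sq (s + r)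
    have he : ∀ i j : Fin 7, inner ℝ (e i) (e j) = if i = j then (1 : ℝ) else 0 :=
      orthonormal_iff_ite.mp (EuclideanSpace.orthonormal_single (𝕜 := ℝ) (ι := Fin 7))
    have key : ∀ (a b c d : ℝ) (i j k l : Fin 7),
        inner ℝ (a • e i + b • e j) (c • e k + d • e l) =
          a * c * (if i = k then 1 else 0) + a * d * (if i = l then 1 else 0)
          + b * c * (if j = k then 1 else 0) + b * d * (if j = l then (1 : ℝ) else 0) := by
      intro a b c d i j k l
      simp only [inner_add_left, inner_add_right, real_inner_smul_left, real_inner_smul_right, he]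
      ring
    intro i j
    fin_cases i <;> fin_cases j <;>
      simp [-real_inner_self_eq_norm_sq, -inner_self_eq_norm_sq_to_K, w1, w2, w3, key] <;>
      linarith [h1, h2, h3]
  have hphi : phi0 (w1 s r) (w2 s r) (w3 s r) = 1 := by
    have ha : 2 * s = (s - r) + (s + r) := by ring
    have h := Real.cos_sq_add_sin_sq ((s - r) + (s + r))
    simp [phi0, trip, Matrix.det_fin_three, w1, w2, w3, e, Fin.ext_iff]
    rw [ha]
    rw [← h]
    generalize s - r = b
    generalize s + r = c
    rw [Real.cos_add, Real.sin_add]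
    ring
  exact ⟨horth, hphi, _, _, _, horth, hphi, rfl⟩
end
end

section
/- Let s, r ∈ ℝ satisfy s ≥ 0, 3s ≤ r, and r ≤ π/2. Then: (1) if s = 0 and r = 0, then P_{s,r} = A, so dim(P_{s,r} ∩ A) = 3; (2) if s = 0 and r ≠ 0, then dim(P_{s,r} ∩ A) = 1; (3) if s > 0, then dim(P_{s,r} ∩ A) = 0. In particular, dim(P_{s,r} ∩ A) = 1 if and only if s = 0 and r ≠ 0. -/
open Real

noncomputable section

lemma mem_A_coords {x : E7} (hx : x ∈ A) : x 3 = 0 ∧ x 4 = 0 ∧ x 5 = 0 := by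
  unfold A at hx
  rw [Submodule.mem_span_triple] at hx
  obtain ⟨a, b, c, rfl⟩ := hx
  simp [e]

lemma mem_inf {s r : ℝ} {x : E7} (hx : x ∈ Psr s r ⊓ A) :
    ∃ a b c : ℝ, a • w1 s r + b • w2 s r + c • w3 s r = x ∧
      a * Real.sin (2 * s) = 0 ∧ b * Real.sin (s - r) = 0 ∧ c * Real.sin (s + r) = 0 := by
  obtain ⟨h1, h2⟩ := Submodule.mem_inf.1 hx
  unfold Psr at h1
  rw [Submodule.mem_span_triple] at h1
  obtain ⟨a, b, c, rfl⟩ := h1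
  obtain ⟨h3, h4, h5⟩ := mem_A_coords h2
  refine ⟨a, b, c, rfl, ?_, ?_, ?_⟩
  · simpa [w1, w2, w3, e] using h5
  · simpa [w1, w2, w3, e] using h4
  · simpa [w1, w2, w3, e] using h3

lemma finrank_A : Module.finrank ℝ ↥A = 3 := by
  have hli : LinearIndependent ℝ ![e 0, e 1, e 2] := by
    rw [Fintype.linearIndependent_iff]
    intro g hg
    have h0 := congrArg (fun v : E7 => v 0) hg
    have h1 := congrArg (fun v : E7 => v 1) hg
    have h2 := congrArg (fun v : E7 => v 2) hg
    simp [Fin.sum_univ_three, e] at h0 h1 h2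
    intro i
    fin_cases i <;> simpa
  have h := finrank_span_eq_card hli
  have hr : Set.range ![e 0, e 1, e 2] = {e 0, e 1, e 2} := by
    ext x
    simp
    tauto
  rw [hr] at h
  unfold A
  exact h.trans (by simp)

lemma case_zero : Psr 0 0 = A := by
  simp [Psr, A, w1, w2, w3]

lemma case_one (r : ℝ) (h : Real.sin r ≠ 0) : Module.finrank ℝ ↥(Psr 0 r ⊓ A) = 1 := by
  have hw : w1 0 r = e 0 := by simp [w1]
  have : Psr 0 r ⊓ A = Submodule.span ℝ {e 0} := by
    apply le_antisymm
    · intro x hx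
      obtain ⟨a, b, c, rfl, -, hb, hc⟩ := mem_inf hx
      simp [h] at hb hc
      subst hb hc
      rw [Submodule.mem_span_singleton]
      exact ⟨a, by simp [hw]⟩
    · rw [Submodule.span_singleton_le_iff_mem]
      refine Submodule.mem_inf.2 ⟨?_, Submodule.subset_span (by simp)⟩
      rw [← hw]
      exact Submodule.subset_span (by simp)
  rw [this]
  apply finrank_span_singleton
  simp [e]

lemma case_pos {s r : ℝ} (h1 : Real.sin (2 * s) ≠ 0) (h2 : Real.sin (s - r) ≠ 0)
    (h3 : Real.sin (s + r) ≠ 0) : Module.finrank ℝ ↥(Psr s r ⊓ A) = 0 := by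
  have : Psr s r ⊓ A = ⊥ := by
    rw [eq_bot_iff]
    intro x hx
    obtain ⟨a, b, c, rfl, ha, hb, hc⟩ := mem_inf hx
    simp only [mul_eq_zero, h1, h2, h3, or_false] at ha hb hc
    simp [ha, hb, hc]
  rw [this]
  simp

/-- Dimension of P_{s,r} ∩ A in the normal-form range: 3 if s = r = 0, 1 if s = 0 ≠ r,
0 if s > 0; in particular dim(P_{s,r} ∩ A) = 1 iff s = 0 and r ≠ 0. -/
theorem statement5 (s r : ℝ) (hs : 0 ≤ s) (hsr : 3 * s ≤ r) (hr : r ≤ π / 2) :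
    (s = 0 → r = 0 → Psr s r = A ∧ Module.finrank ℝ ↥(Psr s r ⊓ A) = 3) ∧
    (s = 0 → r ≠ 0 → Module.finrank ℝ ↥(Psr s r ⊓ A) = 1) ∧
    (0 < s → Module.finrank ℝ ↥(Psr s r ⊓ A) = 0) ∧
    (Module.finrank ℝ ↥(Psr s r ⊓ A) = 1 ↔ s = 0 ∧ r ≠ 0) := by
  have c1 : s = 0 → r = 0 → Psr s r = A ∧ Module.finrank ℝ ↥(Psr s r ⊓ A) = 3 := by
    rintro rfl rfl
    rw [case_zero, inf_idem]
    exact ⟨rfl, finrank_A⟩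
  have c2 : s = 0 → r ≠ 0 → Module.finrank ℝ ↥(Psr s r ⊓ A) = 1 := by
    rintro rfl h
    have : 0 < r := lt_of_le_of_ne (by linarith) (Ne.symm h)
    exact case_one r (Real.sin_pos_of_pos_of_lt_pi this (by linarith [Real.pi_pos])).ne'
  have c3 : 0 < s → Module.finrank ℝ ↥(Psr s r ⊓ A) = 0 := by
    intro h
    have hp := Real.pi_pos
    refine case_pos (Real.sin_pos_of_pos_of_lt_pi (by linarith) (by linarith)).ne'
      (Real.sin_neg_of_neg_of_neg_pi_lt (by linarith) (by linarith)).ne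
      (Real.sin_pos_of_pos_of_lt_pi (by linarith) (by linarith)).ne'
  refine ⟨c1, c2, c3, fun h => ?_, fun h => c2 h.1 h.2⟩
  rcases hs.eq_or_lt with h0 | h0
  · refine ⟨h0.symm, fun hr0 => ?_⟩
    have := (c1 h0.symm hr0).2
    omega
  · have := c3 h0
    omega
end
end

section
/- Let V be a finite-dimensional complex inner product space and let E ⊆ V be a 2-dimensional real subspace of V (viewed as a real vector space). Then E is J-invariant (i.e., i·x ∈ E for every x ∈ E) if and only if every (2,0)-form β on V satisfies β(u,v) = 0 for all u, v ∈ E. -/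
noncomputable section

lemma aux_finrank {V : Type*} [NormedAddCommGroup V] [InnerProductSpace ℂ V]
    (x : V) (hx : x ≠ 0) :
    Module.finrank ℝ ((Submodule.span ℂ {x}).restrictScalars ℝ) = 2 := by
  have h1 : Module.finrank ℝ (Submodule.span ℂ {x}) = 2 := by
    rw [finrank_real_of_complex, finrank_span_singleton hx]
  exact h1

lemma aux_form {V : Type*} [NormedAddCommGroup V] [InnerProductSpace ℂ V]
    (x v : V) (hx : x ≠ 0)
    (h : ∀ β : V →ₗ[ℂ] V →ₗ[ℂ] ℂ, (∀ u v : V, β u v = - β v u) → β x v = 0) :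
    v ∈ Submodule.span ℂ {x} := by
  have hxx : inner ℂ x x ≠ 0 := inner_self_ne_zero.mpr hx
  set y : V := inner ℂ x x • v - inner ℂ x v • x with hy
  let f : V →ₗ[ℂ] ℂ := (innerSL ℂ x).toLinearMap
  let g : V →ₗ[ℂ] ℂ := (innerSL ℂ y).toLinearMap
  have hf : ∀ w, f w = inner ℂ x w := fun w => rfl
  have hg : ∀ w, g w = inner ℂ y w := fun w => rfl
  have hb := h (f.smulRight g - g.smulRight f) (by
    intro u w
    simp
    ring)
  have hxy : inner ℂ x y = 0 := by
    rw [hy, inner_sub_right, inner_smul_right, inner_smul_right]; ring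
  have hyx : inner ℂ y x = 0 := inner_eq_zero_symm.mp hxy
  simp only [LinearMap.sub_apply, LinearMap.smulRight_apply, LinearMap.smul_apply, hf, hg,
    smul_eq_mul, hyx, zero_mul, sub_zero] at hb
  have hyy : inner ℂ y y = 0 := by
    conv_lhs => rw [hy, ← hy]
    nth_rewrite 2 [hy]
    rw [inner_sub_right, inner_smul_right, inner_smul_right, hb, hyx]; ring
  have hy0 : y = 0 := inner_self_eq_zero.mp hyy
  rw [Submodule.mem_span_singleton]
  refine ⟨(inner ℂ x x)⁻¹ * inner ℂ x v, ?_⟩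
  rw [mul_smul, ← sub_eq_zero.mp (hy.symm.trans hy0), smul_smul, inv_mul_cancel₀ hxx, one_smul]

/-- A 2-dimensional real subspace E of a finite-dimensional Hermitian vector space V is
J-invariant (i.e. closed under multiplication by i) if and only if every (2,0)-form on V
(ℂ-bilinear alternating map V × V → ℂ) vanishes on E. -/
theorem statement6 {V : Type*} [NormedAddCommGroup V] [InnerProductSpace ℂ V]
    [FiniteDimensional ℂ V] (E : Submodule ℝ V) (hE : Module.finrank ℝ E = 2) :
    (∀ x ∈ E, (Complex.I : ℂ) • x ∈ E) ↔
      (∀ β : V →ₗ[ℂ] V →ₗ[ℂ] ℂ, (∀ u v : V, β u v = - β v u) →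
        ∀ u ∈ E, ∀ v ∈ E, β u v = 0) := by
  haveI : FiniteDimensional ℝ V := FiniteDimensional.complexToReal V
  constructor
  · intro hJ β hβ u hu v hv
    by_cases hu0 : u = 0
    · simp [hu0]
    have hle : (Submodule.span ℂ {u}).restrictScalars ℝ ≤ E := by
      intro w hw
      rw [Submodule.restrictScalars_mem, Submodule.mem_span_singleton] at hw
      obtain ⟨c, rfl⟩ := hw
      have : c • u = c.re • u + c.im • (Complex.I • u) := by
        conv_lhs => rw [← Complex.re_add_im c]
        rw [add_smul, mul_smul, Complex.coe_smul, Complex.coe_smul]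
      rw [this]
      exact E.add_mem (E.smul_mem _ hu) (E.smul_mem _ (hJ u hu))
    have heq := Submodule.eq_of_le_of_finrank_eq hle ((aux_finrank u hu0).trans hE.symm)
    rw [← heq, Submodule.restrictScalars_mem, Submodule.mem_span_singleton] at hv
    obtain ⟨c, rfl⟩ := hv
    have : β u u = 0 := self_eq_neg.mp (hβ u u)
    simp [this]
  · intro h x hx
    by_cases hx0 : x = 0
    · simp [hx0]
    have hle : E ≤ (Submodule.span ℂ {x}).restrictScalars ℝ := by
      intro v hv
      rw [Submodule.restrictScalars_mem]
      exact aux_form x v hx0 fun β hβ => h β hβ x hx v hv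
    have heq := Submodule.eq_of_le_of_finrank_eq hle (hE.trans (aux_finrank x hx0).symm)
    rw [heq, Submodule.restrictScalars_mem]
    exact Submodule.smul_mem _ _ (Submodule.mem_span_singleton_self x)
end
end
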